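/- arXiv:1911.00464 — 6 statements merged into one kernel-verified Lean document; each statement's English description precedes it below -/
import Mathlib

section
/- Let d ≥ 3. For all nonnegative functions f, g : ℤ^d → [0,∞) and all x ∈ ℤ^d, the discrete bilinear spherical maximal operator satisfies the pointwise product bound T*(f,g)(x) ≤ M f(x) · S g(x), where M is the discrete Hardy–Littlewood maximal operator and S is the discrete (linear) spherical maximal operator. -/
open scoped ENNReal NNReal BigOperators

noncomputable section

/-- `|u|² = ∑ i, u i ^ 2` for `u ∈ ℤ^d`. -/
def normSq {d : ℕ} (u : Fin d → ℤ) : ℤ := ∑ i, u i ^ 2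

/-- The discrete bilinear spherical maximal operator on nonnegative functions:
`T*(f,g)(x) = sup_{λ ≥ 1} λ^{-(d-1)} ∑_{|u|²+|v|²=λ} f(x-u) g(x-v)`, valued in `ℝ≥0∞`. -/
def biMaxNN (d : ℕ) (f g : (Fin d → ℤ) → ℝ≥0) (x : Fin d → ℤ) : ℝ≥0∞ :=
  ⨆ (lam : ℕ) (_ : 1 ≤ lam),
    ((lam : ℝ≥0∞) ^ (d - 1))⁻¹ *
      ∑' p : {p : (Fin d → ℤ) × (Fin d → ℤ) // normSq p.1 + normSq p.2 = (lam : ℤ)},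
        (f (x - p.1.1) : ℝ≥0∞) * (g (x - p.1.2) : ℝ≥0∞)

/-- The discrete Hardy–Littlewood maximal operator
`M f(x) = sup_{λ ≥ 1} λ^{-d/2} ∑_{|u|² ≤ λ} f(x-u)`. -/
def hlMax (d : ℕ) (f : (Fin d → ℤ) → ℝ≥0) (x : Fin d → ℤ) : ℝ≥0∞ :=
  ⨆ (lam : ℕ) (_ : 1 ≤ lam),
    ((lam : ℝ≥0∞) ^ ((d : ℝ) / 2))⁻¹ *
      ∑' u : {u : Fin d → ℤ // normSq u ≤ (lam : ℤ)}, (f (x - u.1) : ℝ≥0∞)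

/-- The discrete (linear) spherical maximal operator
`S g(x) = max( g(x), sup_{μ ≥ 1} μ^{-(d/2-1)} ∑_{|v|²=μ} g(x-v) )`,
the term `g(x)` accounting for the degenerate sphere `μ = 0`. -/
def sphMax (d : ℕ) (g : (Fin d → ℤ) → ℝ≥0) (x : Fin d → ℤ) : ℝ≥0∞ :=
  max (g x : ℝ≥0∞)
    (⨆ (μ : ℕ) (_ : 1 ≤ μ),
      ((μ : ℝ≥0∞) ^ ((d : ℝ) / 2 - 1))⁻¹ *
        ∑' v : {v : Fin d → ℤ // normSq v = (μ : ℤ)}, (g (x - v.1) : ℝ≥0∞))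

theorem normSq_nonneg {d : ℕ} (u : Fin d → ℤ) : 0 ≤ normSq u :=
  Finset.sum_nonneg fun i _ => sq_nonneg (u i)

theorem normSq_eq_zero_iff {d : ℕ} (u : Fin d → ℤ) : normSq u = 0 ↔ u = 0 := by
  unfold normSq
  rw [Finset.sum_eq_zero_iff_of_nonneg fun i _ => sq_nonneg (u i)]
  simp [funext_iff]

theorem natCast_rpow_ne_zero {n : ℕ} (hn : 1 ≤ n) (s : ℝ) : (n : ℝ≥0∞) ^ s ≠ 0 :=
  (ENNReal.rpow_pos (by exact_mod_cast hn) (ENNReal.natCast_ne_top n)).ne'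

theorem natCast_rpow_ne_top {n : ℕ} (hn : 1 ≤ n) (s : ℝ) : (n : ℝ≥0∞) ^ s ≠ ⊤ :=
  ENNReal.rpow_ne_top_of_ne_zero (by exact_mod_cast (Nat.one_le_iff_ne_zero.mp hn))
    (ENNReal.natCast_ne_top n)

theorem tsum_ball_le_hlMax (d : ℕ) (f : (Fin d → ℤ) → ℝ≥0) (x : Fin d → ℤ) {lam : ℕ}
    (hlam : 1 ≤ lam) :
    ∑' u : {u : Fin d → ℤ // normSq u ≤ (lam : ℤ)}, (f (x - u.1) : ℝ≥0∞) ≤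
      (lam : ℝ≥0∞) ^ ((d : ℝ) / 2) * hlMax d f x := by
  rw [← ENNReal.inv_mul_le_iff (natCast_rpow_ne_zero hlam _) (natCast_rpow_ne_top hlam _)]
  exact le_iSup₂_of_le lam hlam le_rfl

/-- A sum over a sphere, possibly degenerate, of squared radius at most `lam`. -/
theorem tsum_sphere_le_sphMax (d : ℕ) (hd : 2 ≤ d) (g : (Fin d → ℤ) → ℝ≥0) (x : Fin d → ℤ)
    {lam mu : ℕ} (hlam : 1 ≤ lam) (hmu : mu ≤ lam) :
    ∑' v : {v : Fin d → ℤ // normSq v = (mu : ℤ)}, (g (x - v.1) : ℝ≥0∞) ≤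
      (lam : ℝ≥0∞) ^ ((d : ℝ) / 2 - 1) * sphMax d g x := by
  have hs : 0 ≤ (d : ℝ) / 2 - 1 := by
    have : (2 : ℝ) ≤ d := by exact_mod_cast hd
    linarith
  rcases Nat.eq_zero_or_pos mu with rfl | hpos
  · have hone : (1 : ℝ≥0∞) ≤ (lam : ℝ≥0∞) ^ ((d : ℝ) / 2 - 1) := by
      simpa using ENNReal.rpow_le_rpow (z := (d : ℝ) / 2 - 1)
        (show (1 : ℝ≥0∞) ≤ lam by exact_mod_cast hlam) hs
    rw [tsum_eq_single ⟨0, by simp [normSq]⟩ fun v hv =>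
      absurd (Subtype.ext ((normSq_eq_zero_iff v.1).mp (by simpa using v.2))) hv]
    calc (g (x - 0) : ℝ≥0∞) ≤ sphMax d g x := by rw [sub_zero]; exact le_max_left _ _
      _ ≤ _ := le_mul_of_one_le_left' hone
  · calc _ ≤ (mu : ℝ≥0∞) ^ ((d : ℝ) / 2 - 1) * sphMax d g x := by
          rw [← ENNReal.inv_mul_le_iff (natCast_rpow_ne_zero hpos _) (natCast_rpow_ne_top hpos _)]
          exact le_max_of_le_right (le_iSup₂_of_le mu hpos le_rfl)
      _ ≤ _ := by gcongr

/-- Slicing: fix `u` in the ball and let `v` run over the complementary sphere. -/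
theorem tsum_pair_sphere_le (d : ℕ) (F G : (Fin d → ℤ) → ℝ≥0∞) (lam : ℕ) :
    ∑' p : {p : (Fin d → ℤ) × (Fin d → ℤ) // normSq p.1 + normSq p.2 = (lam : ℤ)},
        F p.1.1 * G p.1.2 ≤
      ∑' u : {u : Fin d → ℤ // normSq u ≤ (lam : ℤ)},
        F u.1 * ∑' v : {v : Fin d → ℤ // normSq v = ((lam - (normSq u.1).toNat : ℕ) : ℤ)},
          G v.1 := by
  simp_rw [← ENNReal.tsum_mul_left]
  let e : {p : (Fin d → ℤ) × (Fin d → ℤ) // normSq p.1 + normSq p.2 = (lam : ℤ)} →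
      (Σ u : {u : Fin d → ℤ // normSq u ≤ (lam : ℤ)},
        {v : Fin d → ℤ // normSq v = ((lam - (normSq u.1).toNat : ℕ) : ℤ)}) := fun p =>
    ⟨⟨p.1.1, by have := normSq_nonneg p.1.2; have := p.2; omega⟩,
      ⟨p.1.2, by
        have := normSq_nonneg p.1.1
        have := normSq_nonneg p.1.2
        have := p.2
        dsimp only
        omega⟩⟩
  have he : Function.Injective e := fun p q h => by
    have h₁ : p.1.1 = q.1.1 := congrArg (fun t => t.1.1) h
    have h₂ : p.1.2 = q.1.2 := congrArg (fun t => t.2.1) h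
    exact Subtype.ext (Prod.ext h₁ h₂)
  exact (ENNReal.tsum_comp_le_tsum_of_injective he fun t => F t.1.1 * G t.2.1).trans_eq
    (ENNReal.tsum_sigma' _)

/-- For `d ≥ 3` and nonnegative `f, g`, the pointwise bound `T*(f,g)(x) ≤ M f(x) · S g(x)`. -/
theorem bilinear_pointwise_product_bound
    (d : ℕ) (hd : 3 ≤ d) (f g : (Fin d → ℤ) → ℝ≥0) (x : Fin d → ℤ) :
    biMaxNN d f g x ≤ hlMax d f x * sphMax d g x := by
  refine iSup₂_le fun lam hlam => ?_
  have hpow : (lam : ℝ≥0∞) ^ (d - 1) =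
      (lam : ℝ≥0∞) ^ ((d : ℝ) / 2) * (lam : ℝ≥0∞) ^ ((d : ℝ) / 2 - 1) := by
    rw [← ENNReal.rpow_add _ _ (by exact_mod_cast (Nat.one_le_iff_ne_zero.mp hlam))
      (ENNReal.natCast_ne_top lam), ← ENNReal.rpow_natCast, Nat.cast_sub (by omega)]
    congr 1
    push_cast
    ring
  rw [hpow, ENNReal.inv_mul_le_iff
    (mul_ne_zero (natCast_rpow_ne_zero hlam _) (natCast_rpow_ne_zero hlam _))
    (ENNReal.mul_ne_top (natCast_rpow_ne_top hlam _) (natCast_rpow_ne_top hlam _))]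
  calc _ ≤ _ := tsum_pair_sphere_le d (fun u => f (x - u)) (fun v => g (x - v)) lam
    _ ≤ ∑' u : {u : Fin d → ℤ // normSq u ≤ (lam : ℤ)},
        (f (x - u.1) : ℝ≥0∞) * ((lam : ℝ≥0∞) ^ ((d : ℝ) / 2 - 1) * sphMax d g x) :=
      ENNReal.tsum_le_tsum fun u => mul_le_mul_right
        (tsum_sphere_le_sphMax d (by omega) g x hlam (Nat.sub_le _ _)) _
    _ ≤ ((lam : ℝ≥0∞) ^ ((d : ℝ) / 2) * hlMax d f x) *
        ((lam : ℝ≥0∞) ^ ((d : ℝ) / 2 - 1) * sphMax d g x) := by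
      rw [ENNReal.tsum_mul_right]
      exact mul_le_mul_left (tsum_ball_le_hlMax d f x hlam) _
    _ = _ := by ring
end
end

section
/- Let d ≥ 1 and let f = χ_{[-1,1]^d} be the indicator function of the cube {u ∈ ℤ^d : |u_i| ≤ 1 for all i} and g = δ_0 the indicator function of {0}. Then for every nonzero x ∈ ℤ^d, the discrete bilinear spherical maximal function satisfies the lower bound T*(f,g)(x) ≥ (2|x|²)^{-(d-1)}, obtained by testing the average at radius parameter λ = 2|x|². -/
open scoped ENNReal NNReal BigOperators

noncomputable section

/-- A nonzero integer vector has positive square norm. -/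
theorem normSq_pos {d : ℕ} {x : Fin d → ℤ} (hx : x ≠ 0) : 0 < normSq x := by
  obtain ⟨i, hi⟩ := Function.ne_iff.mp hx
  exact Finset.sum_pos' (fun j _ => sq_nonneg (x j))
    ⟨i, Finset.mem_univ i, sq_pos_of_ne_zero hi⟩

/-- With `f = χ_{[-1,1]^d}` and `g = δ₀`, for every nonzero `x ∈ ℤ^d` one has
`T*(f,g)(x) ≥ (2|x|²)^{-(d-1)}` (testing at radius parameter `λ = 2|x|²`). -/
theorem bilinear_lower_bound
    (d : ℕ) (hd : 1 ≤ d) (x : Fin d → ℤ) (hx : x ≠ 0) :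
    (((2 * (normSq x).toNat : ℕ) : ℝ≥0∞) ^ (d - 1))⁻¹ ≤
      biMaxNN d (fun u => if ∀ i, |u i| ≤ 1 then 1 else 0)
        (fun u => if u = 0 then 1 else 0) x := by
  have hpos := normSq_pos hx
  have hsphere : normSq x + normSq x = ((2 * (normSq x).toNat : ℕ) : ℤ) := by omega
  refine le_trans ?_ (le_iSup₂ (2 * (normSq x).toNat) (by omega))
  refine le_mul_of_one_le_right' ?_
  refine le_trans ?_ (ENNReal.le_tsum ⟨(x, x), hsphere⟩)
  simp
end
end

section
/- Let d ≥ 2 and ℓ ≥ 2 be integers with (ℓ-1)d ≥ 2. For all nonnegative functions f_1, …, f_ℓ : ℤ^d → [0,∞) and all x ∈ ℤ^d, the ℓ-linear discrete spherical maximal operator satisfies the pointwise product bound T*(f_1,…,f_ℓ)(x) ≤ M f_1(x) · S^{ℓ-1}(f_2,…,f_ℓ)(x), where M is the discrete Hardy–Littlewood maximal operator and S^{ℓ-1} is the (ℓ-1)-linear discrete spherical maximal operator. -/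
open scoped ENNReal NNReal BigOperators

noncomputable section

/-- The `ℓ`-linear discrete spherical maximal operator on nonnegative functions:
`T*(f_1,…,f_ℓ)(x) = sup_{λ ≥ 1} λ^{-(ℓd/2-1)} ∑_{|u_1|²+⋯+|u_ℓ|²=λ} f_1(x-u_1)⋯f_ℓ(x-u_ℓ)`,
valued in `ℝ≥0∞`. -/
def multMaxNN (d l : ℕ) (f : Fin l → (Fin d → ℤ) → ℝ≥0) (x : Fin d → ℤ) : ℝ≥0∞ :=
  ⨆ (lam : ℕ) (_ : 1 ≤ lam),
    ((lam : ℝ≥0∞) ^ ((((l * d : ℕ) : ℝ)) / 2 - 1))⁻¹ *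
      ∑' u : {u : Fin l → Fin d → ℤ // ∑ i, normSq (u i) = (lam : ℤ)},
        ∏ i, (f i (x - u.1 i) : ℝ≥0∞)

/-- The `m`-linear discrete spherical maximal operator (including the degenerate sphere
`μ = 0`, accounted for by the product term):
`S^m(g_1,…,g_m)(x) = max( ∏ g_i(x), sup_{μ ≥ 1} μ^{-(md/2-1)} ∑_{|v_1|²+⋯+|v_m|²=μ}
g_1(x-v_1)⋯g_m(x-v_m) )`. -/
def multSphMaxNN (d m : ℕ) (g : Fin m → (Fin d → ℤ) → ℝ≥0) (x : Fin d → ℤ) : ℝ≥0∞ :=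
  max (∏ i, (g i x : ℝ≥0∞))
    (⨆ (μ : ℕ) (_ : 1 ≤ μ),
      ((μ : ℝ≥0∞) ^ ((((m * d : ℕ) : ℝ)) / 2 - 1))⁻¹ *
        ∑' v : {v : Fin m → Fin d → ℤ // ∑ i, normSq (v i) = (μ : ℤ)},
          ∏ i, (g i (x - v.1 i) : ℝ≥0∞))

theorem eq_zero_of_normSq_eq_zero {d : ℕ} {u : Fin d → ℤ} (h : normSq u = 0) : u = 0 := by
  ext i
  have := (Finset.sum_eq_zero_iff_of_nonneg fun i _ => sq_nonneg (u i)).1 h i (Finset.mem_univ i)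
  simpa using this

/-- Summation over the degenerate sphere gives at most the value at the centre. -/
theorem tsum_sphere_zero_le {d m : ℕ} (g : Fin m → (Fin d → ℤ) → ℝ≥0) (x : Fin d → ℤ) :
    ∑' v : {v : Fin m → Fin d → ℤ // ∑ i, normSq (v i) = 0},
      ∏ i, (g i (x - v.1 i) : ℝ≥0∞) ≤ ∏ i, (g i x : ℝ≥0∞) := by
  have hv (v : {v : Fin m → Fin d → ℤ // ∑ i, normSq (v i) = 0}) (i : Fin m) : v.1 i = 0 :=
    eq_zero_of_normSq_eq_zero <|
      (Finset.sum_eq_zero_iff_of_nonneg fun i _ => normSq_nonneg (v.1 i)).1 v.2 i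
        (Finset.mem_univ i)
  have : Subsingleton {v : Fin m → Fin d → ℤ // ∑ i, normSq (v i) = 0} :=
    ⟨fun v w => Subtype.ext (funext fun i => (hv v i).trans (hv w i).symm)⟩
  have h0 : ∑ i : Fin m, normSq ((0 : Fin m → Fin d → ℤ) i) = 0 := by simp [normSq]
  rw [tsum_eq_single ⟨0, h0⟩ fun w hw => (hw (Subsingleton.elim _ _)).elim]
  simp

/-- Sums over spheres of radius at most `√lam` are controlled by the spherical maximal operator. -/
theorem tsum_sphere_le {d m : ℕ} (hmd : 2 ≤ m * d) (g : Fin m → (Fin d → ℤ) → ℝ≥0)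
    (x : Fin d → ℤ) {lam : ℕ} (hlam : 1 ≤ lam) {k : ℤ} (hk : k ≤ lam) :
    ∑' v : {v : Fin m → Fin d → ℤ // ∑ i, normSq (v i) = k}, ∏ i, (g i (x - v.1 i) : ℝ≥0∞) ≤
      (lam : ℝ≥0∞) ^ (((m * d : ℕ) : ℝ) / 2 - 1) * multSphMaxNN d m g x := by
  have hmd' : (2 : ℝ) ≤ ((m * d : ℕ) : ℝ) := by exact_mod_cast hmd
  have he : 0 ≤ ((m * d : ℕ) : ℝ) / 2 - 1 := by linarith
  rcases lt_trichotomy k 0 with hk0 | rfl | hk0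
  · have : IsEmpty {v : Fin m → Fin d → ℤ // ∑ i, normSq (v i) = k} :=
      ⟨fun v => (hk0.trans_le (v.2 ▸ Finset.sum_nonneg fun i _ => normSq_nonneg (v.1 i))).false⟩
    simp
  · have hS : ∏ i, (g i x : ℝ≥0∞) ≤ multSphMaxNN d m g x := le_max_left _ _
    refine ((tsum_sphere_zero_le g x).trans hS).trans ?_
    have hlam' : (1 : ℝ≥0∞) ≤ lam := by exact_mod_cast hlam
    refine le_mul_of_one_le_left' ?_
    simpa using ENNReal.rpow_le_rpow hlam' he
  · lift k to ℕ using hk0.le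
    have hk1 : 1 ≤ k := by exact_mod_cast hk0
    have hkl : k ≤ lam := by exact_mod_cast hk
    have hk_ne : (k : ℝ≥0∞) ≠ 0 := by exact_mod_cast (by omega : k ≠ 0)
    have hpos : (k : ℝ≥0∞) ^ (((m * d : ℕ) : ℝ) / 2 - 1) ≠ 0 := by
      simp [ENNReal.rpow_eq_zero_iff, hk_ne]
    have htop : (k : ℝ≥0∞) ^ (((m * d : ℕ) : ℝ) / 2 - 1) ≠ ∞ :=
      ENNReal.rpow_ne_top_of_nonneg he (ENNReal.natCast_ne_top k)
    calc _ ≤ (k : ℝ≥0∞) ^ (((m * d : ℕ) : ℝ) / 2 - 1) * multSphMaxNN d m g x := by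
          rw [← ENNReal.inv_mul_le_iff hpos htop]
          exact (le_iSup₂ (f := fun (μ : ℕ) (_ : 1 ≤ μ) =>
            ((μ : ℝ≥0∞) ^ ((((m * d : ℕ) : ℝ)) / 2 - 1))⁻¹ *
              ∑' v : {v : Fin m → Fin d → ℤ // ∑ i, normSq (v i) = (μ : ℤ)},
                ∏ i, (g i (x - v.1 i) : ℝ≥0∞)) k hk1).trans (le_max_right _ _)
      _ ≤ _ := by
          gcongr

/-- Slicing a sphere along its first vector component. -/
theorem tsum_sphere_cons_le {d m : ℕ} (f₁ : (Fin d → ℤ) → ℝ≥0)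
    (g : Fin m → (Fin d → ℤ) → ℝ≥0) (x : Fin d → ℤ) (k : ℤ) :
    ∑' u : {u : Fin (m + 1) → Fin d → ℤ // ∑ i, normSq (u i) = k},
        ∏ i, ((Fin.cons f₁ g : Fin (m + 1) → (Fin d → ℤ) → ℝ≥0) i (x - u.1 i) : ℝ≥0∞) ≤
      ∑' u : {u : Fin d → ℤ // normSq u ≤ k}, (f₁ (x - u.1) : ℝ≥0∞) *
        ∑' v : {v : Fin m → Fin d → ℤ // ∑ i, normSq (v i) = k - normSq u.1},
          ∏ i, (g i (x - v.1 i) : ℝ≥0∞) := by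
  have hsum (u : {u : Fin (m + 1) → Fin d → ℤ // ∑ i, normSq (u i) = k}) :
      ∑ i : Fin m, normSq (u.1 i.succ) = k - normSq (u.1 0) := by
    have := u.2
    rw [Fin.sum_univ_succ] at this
    linarith
  have hle (u : {u : Fin (m + 1) → Fin d → ℤ // ∑ i, normSq (u i) = k}) :
      normSq (u.1 0) ≤ k := by
    have := Finset.sum_nonneg fun (i : Fin m) (_ : i ∈ Finset.univ) => normSq_nonneg (u.1 i.succ)
    rw [hsum u] at this
    linarith
  let slice (u : {u : Fin (m + 1) → Fin d → ℤ // ∑ i, normSq (u i) = k}) :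
      Σ u : {u : Fin d → ℤ // normSq u ≤ k},
        {v : Fin m → Fin d → ℤ // ∑ i, normSq (v i) = k - normSq u.1} :=
    ⟨⟨u.1 0, hle u⟩, ⟨fun i => u.1 i.succ, hsum u⟩⟩
  have hinj : Function.Injective slice := by
    intro u w h
    have h0 : u.1 0 = w.1 0 := congrArg (fun p => p.1.1) h
    have hs : (fun i : Fin m => u.1 i.succ) = fun i => w.1 i.succ := congrArg (fun p => p.2.1) h
    ext i : 2
    exact Fin.cases h0 (congrFun hs) i
  simp_rw [← ENNReal.tsum_mul_left]
  rw [← ENNReal.tsum_sigma fun (u : {u : Fin d → ℤ // normSq u ≤ k})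
    (v : {v : Fin m → Fin d → ℤ // ∑ i, normSq (v i) = k - normSq u.1}) =>
      (f₁ (x - u.1) : ℝ≥0∞) * ∏ i, (g i (x - v.1 i) : ℝ≥0∞)]
  refine le_trans (le_of_eq ?_) (ENNReal.tsum_comp_le_tsum_of_injective hinj _)
  simp [slice, Fin.prod_univ_succ]

/-- For `d ≥ 2`, `ℓ = m + 1 ≥ 2` with `(ℓ-1)d = md ≥ 2`, and nonnegative functions,
the pointwise bound `T*(f_1,…,f_ℓ)(x) ≤ M f_1(x) · S^{ℓ-1}(f_2,…,f_ℓ)(x)`. -/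
theorem multilinear_pointwise_product_bound
    (d m : ℕ) (hd : 2 ≤ d) (hm : 1 ≤ m) (hmd : 2 ≤ m * d)
    (f₁ : (Fin d → ℤ) → ℝ≥0) (g : Fin m → (Fin d → ℤ) → ℝ≥0) (x : Fin d → ℤ) :
    multMaxNN d (m + 1) (Fin.cons f₁ g) x ≤ hlMax d f₁ x * multSphMaxNN d m g x := by
  refine iSup₂_le fun lam hlam => ?_
  have hlam0 : (lam : ℝ≥0∞) ≠ 0 := by exact_mod_cast (by omega : lam ≠ 0)
  have hpow : ((lam : ℝ≥0∞) ^ (((((m + 1) * d : ℕ) : ℝ)) / 2 - 1))⁻¹ *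
      (lam : ℝ≥0∞) ^ (((m * d : ℕ) : ℝ) / 2 - 1) = ((lam : ℝ≥0∞) ^ ((d : ℝ) / 2))⁻¹ := by
    rw [← ENNReal.rpow_neg, ← ENNReal.rpow_neg,
      ← ENNReal.rpow_add _ _ hlam0 (ENNReal.natCast_ne_top lam)]
    congr 1
    push_cast
    ring
  calc
    _ ≤ ((lam : ℝ≥0∞) ^ (((((m + 1) * d : ℕ) : ℝ)) / 2 - 1))⁻¹ *
        ∑' u : {u : Fin d → ℤ // normSq u ≤ (lam : ℤ)}, (f₁ (x - u.1) : ℝ≥0∞) *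
          ((lam : ℝ≥0∞) ^ (((m * d : ℕ) : ℝ) / 2 - 1) * multSphMaxNN d m g x) := by
      gcongr
      refine (tsum_sphere_cons_le f₁ g x lam).trans (ENNReal.tsum_le_tsum fun u => ?_)
      gcongr
      exact tsum_sphere_le hmd g x hlam (sub_le_self _ (normSq_nonneg u.1))
    _ = ((lam : ℝ≥0∞) ^ ((d : ℝ) / 2))⁻¹ *
          (∑' u : {u : Fin d → ℤ // normSq u ≤ (lam : ℤ)}, (f₁ (x - u.1) : ℝ≥0∞)) *
            multSphMaxNN d m g x := by
      rw [ENNReal.tsum_mul_right, ← hpow]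
      ring
    _ ≤ _ := by
      gcongr
      exact le_iSup₂ (f := fun (lam : ℕ) (_ : 1 ≤ lam) => ((lam : ℝ≥0∞) ^ ((d : ℝ) / 2))⁻¹ *
        ∑' u : {u : Fin d → ℤ // normSq u ≤ (lam : ℤ)}, (f₁ (x - u.1) : ℝ≥0∞)) lam hlam
end
end

section
/- Let k ≥ 2, d ≥ 1, and ℓ ≥ 2 be integers with (ℓ-1)d ≥ k, and let 1 < p_0 < ∞. Suppose the linear degree-k discrete spherical maximal operator S_k is bounded on ℓ^p(ℤ^d) for every p > p_0, i.e. for each p > p_0 there is C_p > 0 with ‖S_k g‖_{ℓ^p(ℤ^d)} ≤ C_p ‖g‖_{ℓ^p(ℤ^d)} for all g : ℤ^d → ℂ. Then for all exponents p_1, …, p_ℓ, r with 1 < p_i < ∞ for 1 ≤ i ≤ ℓ-1, p_0 < p_ℓ < ∞, and 1/r ≤ 1/p_1 + … + 1/p_ℓ, there exists C > 0 such that for all f_1, …, f_ℓ : ℤ^d → ℂ, ‖T^{k,ℓ,*}(f_1,…,f_ℓ)‖_{ℓ^r(ℤ^d)} ≤ C ∏_{i=1}^ℓ ‖f_i‖_{ℓ^{p_i}(ℤ^d)}.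 -/
open scoped ENNReal NNReal BigOperators

noncomputable section

/-- `|u|_k^k = ∑ j, |u j| ^ k` for `u ∈ ℤ^d`. -/
def normK {d : ℕ} (k : ℕ) (u : Fin d → ℤ) : ℤ := ∑ j, |u j| ^ k

/-- The `ℓ`-linear degree-`k` discrete spherical average
`T_λ^{k,ℓ}(f_1,…,f_ℓ)(x) = λ^{-(ℓd/k-1)} ∑_{|u_1|_k^k+⋯+|u_ℓ|_k^k=λ} f_1(x-u_1)⋯f_ℓ(x-u_ℓ)`
(a finite sum). -/
def multAvgK (d k l : ℕ) (f : Fin l → (Fin d → ℤ) → ℂ) (lam : ℕ) (x : Fin d → ℤ) : ℂ :=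
  ((((lam : ℝ) ^ (((l * d : ℕ) : ℝ) / (k : ℝ) - 1))⁻¹ : ℝ) : ℂ) *
    ∑ᶠ (u : Fin l → (Fin d → ℤ)) (_ : ∑ i, normK k (u i) = (lam : ℤ)),
      ∏ i, f i (x - u i)

/-- The `ℓ`-linear degree-`k` discrete spherical maximal operator
`T^{k,ℓ,*}(f_1,…,f_ℓ)(x) = sup_{λ ≥ 1} |T_λ^{k,ℓ}(f_1,…,f_ℓ)(x)|`, valued in `ℝ≥0∞`. -/
def multMaxK (d k l : ℕ) (f : Fin l → (Fin d → ℤ) → ℂ) (x : Fin d → ℤ) : ℝ≥0∞ :=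
  ⨆ (lam : ℕ) (_ : 1 ≤ lam), (‖multAvgK d k l f lam x‖₊ : ℝ≥0∞)

/-- The linear degree-`k` discrete spherical maximal operator
`S_k g(x) = max( |g(x)|, sup_{μ ≥ 1} μ^{-(d/k-1)} |∑_{|v|_k^k=μ} g(x-v)| )`. -/
def linSphMaxK (d k : ℕ) (g : (Fin d → ℤ) → ℂ) (x : Fin d → ℤ) : ℝ≥0∞ :=
  max (‖g x‖₊ : ℝ≥0∞)
    (⨆ (μ : ℕ) (_ : 1 ≤ μ),
      ((μ : ℝ≥0∞) ^ ((d : ℝ) / (k : ℝ) - 1))⁻¹ *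
        (‖∑ᶠ (v : Fin d → ℤ) (_ : normK k v = (μ : ℤ)), g (x - v)‖₊ : ℝ≥0∞))

/-- The `ℓ^p(ℤ^d)` norm of a complex-valued function. -/
def lpNorm (d : ℕ) (p : ℝ) (f : (Fin d → ℤ) → ℂ) : ℝ≥0∞ :=
  (∑' x : Fin d → ℤ, (‖f x‖₊ : ℝ≥0∞) ^ p) ^ (1 / p)

/-- The `ℓ^r(ℤ^d)` norm of an `ℝ≥0∞`-valued function. -/
def lpNormE (d : ℕ) (r : ℝ) (F : (Fin d → ℤ) → ℝ≥0∞) : ℝ≥0∞ :=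
  (∑' x : Fin d → ℤ, F x ^ r) ^ (1 / r)

/-- The discrete cube `{u ∈ ℤ^d : |u_j| ≤ N for all j}`. -/
def discreteCube (d N : ℕ) : Finset (Fin d → ℤ) :=
  Fintype.piFinset fun _ => Finset.Icc (-(N : ℤ)) N

/-- The discrete Hardy–Littlewood maximal function over centred cubes. -/
def cubeMax {d : ℕ} (F : (Fin d → ℤ) → ℝ≥0∞) (x : Fin d → ℤ) : ℝ≥0∞ :=
  ⨆ N : ℕ, (((2 * N + 1 : ℕ) : ℝ≥0∞) ^ d)⁻¹ * ∑ u ∈ discreteCube d N, F (x - u)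

lemma mem_discreteCube {d N : ℕ} {u : Fin d → ℤ} :
    u ∈ discreteCube d N ↔ ∀ j, |u j| ≤ N := by
  simp [discreteCube, abs_le]

lemma card_discreteCube (d N : ℕ) : (discreteCube d N).card = (2 * N + 1) ^ d := by
  have h : ((N : ℤ) + 1 + (N : ℤ)).toNat = 2 * N + 1 := by omega
  simp [discreteCube, Fintype.card_piFinset, h]

lemma mem_closedBall_iff_sub_mem_discreteCube {d N : ℕ} {x y : Fin d → ℤ} :
    y ∈ Metric.closedBall x (N : ℝ) ↔ x - y ∈ discreteCube d N := by
  rw [Metric.mem_closedBall, dist_pi_le_iff (by positivity), mem_discreteCube]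
  refine forall_congr' fun j => ?_
  rw [Int.dist_eq', Pi.sub_apply, abs_sub_comm]
  norm_cast

lemma card_mul_le_of_lt_cubeMax {d : ℕ} (F : (Fin d → ℤ) → ℝ≥0∞) (t : ℝ≥0∞)
    (E : Finset (Fin d → ℤ)) (hE : ∀ x ∈ E, t < cubeMax F x) :
    (E.card : ℝ≥0∞) * t ≤ 5 ^ d * ∑' x, F x := by
  classical
  have hN : ∀ x, ∃ N : ℕ, x ∈ E →
      t * ((2 * N + 1 : ℕ) : ℝ≥0∞) ^ d ≤ ∑ u ∈ discreteCube d N, F (x - u) := by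
    intro x
    by_cases hx : x ∈ E
    · obtain ⟨N, hN⟩ := lt_iSup_iff.1 (hE x hx)
      refine ⟨N, fun _ => ?_⟩
      rw [mul_comm, ← div_eq_mul_inv] at hN
      exact ((ENNReal.lt_div_iff_mul_lt (Or.inl (by positivity))
        (Or.inl (ENNReal.pow_ne_top (ENNReal.natCast_ne_top _)))).1 hN).le
    · exact ⟨0, fun h => absurd h hx⟩
  choose N hN using hN
  obtain ⟨u, huE, hdisj, hcov⟩ :=
    Vitali.exists_disjoint_subfamily_covering_enlargement_closedBall (E : Set (Fin d → ℤ)) id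
      (fun x => (N x : ℝ)) (E.sup N : ℕ)
      (fun a ha => Nat.cast_le.2 (Finset.le_sup (f := N) ha)) 5 (by norm_num)
  lift u to Finset (Fin d → ℤ) using E.finite_toSet.subset huE
  have hcard : E.card ≤ ∑ b ∈ u, (2 * (5 * N b) + 1) ^ d := by
    have hsub : E ⊆ u.biUnion fun b => (discreteCube d (5 * N b)).image (b - ·) := by
      intro a ha
      obtain ⟨b, hb, hab⟩ := hcov a ha
      have h1 : a ∈ Metric.closedBall b ((5 * N b : ℕ) : ℝ) := by
        push_cast
        exact hab (Metric.mem_closedBall_self (by positivity))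
      rw [mem_closedBall_iff_sub_mem_discreteCube] at h1
      exact Finset.mem_biUnion.2 ⟨b, hb, Finset.mem_image.2 ⟨_, h1, by simp⟩⟩
    refine (Finset.card_le_card hsub).trans (Finset.card_biUnion_le.trans ?_)
    refine Finset.sum_le_sum fun b _ => Finset.card_image_le.trans ?_
    rw [card_discreteCube]
  have hcard' : E.card ≤ 5 ^ d * ∑ b ∈ u, (2 * N b + 1) ^ d := by
    refine hcard.trans ?_
    rw [Finset.mul_sum]
    refine Finset.sum_le_sum fun b _ => ?_
    rw [← mul_pow]
    exact Nat.pow_le_pow_left (by omega) d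
  have himg : ∀ b, ∑ y ∈ discreteCube d (N b), F (b - y) =
      ∑ y ∈ (discreteCube d (N b)).image (b - ·), F y := fun b =>
    (Finset.sum_image (fun x _ y _ h => sub_right_injective h)).symm
  have hsum : ∑ b ∈ u, ∑ y ∈ discreteCube d (N b), F (b - y) ≤ ∑' x, F x := by
    simp_rw [himg]
    rw [← Finset.sum_biUnion]
    · exact ENNReal.sum_le_tsum _
    · intro a ha b hb hab
      have := hdisj ha hb hab
      rw [Function.onFun, Set.disjoint_left] at this
      rw [Function.onFun, Finset.disjoint_left]
      rintro y hya hyb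
      obtain ⟨v, hv, rfl⟩ := Finset.mem_image.1 hya
      obtain ⟨w, hw, hwv⟩ := Finset.mem_image.1 hyb
      refine this (a := a - v) (mem_closedBall_iff_sub_mem_discreteCube.2 (by simpa using hv))
        (mem_closedBall_iff_sub_mem_discreteCube.2 ?_)
      change b - w = a - v at hwv
      simpa [← hwv] using hw
  calc (E.card : ℝ≥0∞) * t ≤ ((5 ^ d * ∑ b ∈ u, (2 * N b + 1) ^ d : ℕ) : ℝ≥0∞) * t := by
        gcongr
    _ = 5 ^ d * ∑ b ∈ u, t * ((2 * N b + 1 : ℕ) : ℝ≥0∞) ^ d := by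
        rw [← Finset.mul_sum]
        push_cast
        ring
    _ ≤ 5 ^ d * ∑ b ∈ u, ∑ y ∈ discreteCube d (N b), F (b - y) := by
        gcongr with b hb
        exact hN b (huE hb)
    _ ≤ 5 ^ d * ∑' x, F x := by gcongr

/-- The weak type `(1, 1)` bound for the discrete Hardy–Littlewood maximal function. -/
lemma count_lt_cubeMax_mul_le {d : ℕ} (F : (Fin d → ℤ) → ℝ≥0∞) (t : ℝ≥0∞) :
    MeasureTheory.Measure.count {x | t < cubeMax F x} * t ≤ 5 ^ d * ∑' x, F x := by
  classical
  rw [← MeasureTheory.lintegral_indicator_one (MeasurableSet.of_discrete),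
    MeasureTheory.lintegral_count, ← ENNReal.tsum_mul_right]
  rw [ENNReal.tsum_eq_iSup_sum]
  refine iSup_le fun E => ?_
  refine le_trans (le_of_eq ?_) (card_mul_le_of_lt_cubeMax F t {x ∈ E | t < cubeMax F x}
    fun x hx => (Finset.mem_filter.1 hx).2)
  rw [← Finset.sum_mul]
  simp [Set.indicator_apply]

lemma cubeMax_add_le {d : ℕ} (F G : (Fin d → ℤ) → ℝ≥0∞) (x : Fin d → ℤ) :
    cubeMax (F + G) x ≤ cubeMax F x + cubeMax G x := by
  refine iSup_le fun N => ?_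
  simp only [Pi.add_apply, Finset.sum_add_distrib, mul_add]
  exact add_le_add (le_iSup (fun N : ℕ => (((2 * N + 1 : ℕ) : ℝ≥0∞) ^ d)⁻¹ *
    ∑ u ∈ discreteCube d N, F (x - u)) N) (le_iSup (fun N : ℕ =>
    (((2 * N + 1 : ℕ) : ℝ≥0∞) ^ d)⁻¹ * ∑ u ∈ discreteCube d N, G (x - u)) N)

lemma cubeMax_le_of_le {d : ℕ} {F : (Fin d → ℤ) → ℝ≥0∞} {B : ℝ≥0∞} (hF : ∀ x, F x ≤ B)
    (x : Fin d → ℤ) : cubeMax F x ≤ B := by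
  refine iSup_le fun N => ?_
  calc (((2 * N + 1 : ℕ) : ℝ≥0∞) ^ d)⁻¹ * ∑ u ∈ discreteCube d N, F (x - u)
      ≤ (((2 * N + 1 : ℕ) : ℝ≥0∞) ^ d)⁻¹ * ∑ _u ∈ discreteCube d N, B := by
        gcongr
        exact hF _
    _ = B := by
        rw [Finset.sum_const, card_discreteCube, nsmul_eq_mul, ← mul_assoc]
        push_cast
        rw [ENNReal.inv_mul_cancel, one_mul]
        · positivity
        · exact_mod_cast ENNReal.pow_ne_top (ENNReal.natCast_ne_top (2 * N + 1))

lemma count_lt_cubeMax_mul_half_le {d : ℕ} (F : (Fin d → ℤ) → ℝ≥0∞) (t : ℝ≥0∞) :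
    MeasureTheory.Measure.count {x | t < cubeMax F x} * (t / 2) ≤
      5 ^ d * ∑' x, {x | t / 2 < F x}.indicator F x := by
  refine le_trans ?_ (count_lt_cubeMax_mul_le ({x | t / 2 < F x}.indicator F) (t / 2))
  gcongr 2
  intro x hx
  by_contra hcon
  simp only [Set.mem_ofPred_eq, not_lt] at hcon hx
  refine hx.not_ge ?_
  have h := cubeMax_add_le ({x | t / 2 < F x}.indicator F) ({x | t / 2 < F x}ᶜ.indicator F) x
  rw [Set.indicator_self_add_compl] at h
  refine h.trans ((add_le_add hcon (cubeMax_le_of_le (B := t / 2) (fun y => ?_) x)).trans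
    (ENNReal.add_halves t).le)
  refine Set.indicator_apply_le' (fun hy => ?_) fun _ => zero_le
  simpa using hy

/-- The discrete Hardy–Littlewood maximal function is bounded on `ℓ^p(ℤ^d)` for `p > 1`. -/
lemma exists_tsum_cubeMax_rpow_le (d : ℕ) {p : ℝ} (hp : 1 < p) :
    ∃ C : ℝ≥0, 0 < C ∧ ∀ F : (Fin d → ℤ) → ℝ≥0∞,
      ∑' x, cubeMax F x ^ p ≤ C * ∑' x, F x ^ p := by
  have hp0 : 0 < p := by linarith
  have hC : 0 < p.toNNReal * (2 * 5 ^ d) * ((p - 1).toNNReal)⁻¹ * 2 ^ (p - 1) := by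
    have : 0 < (p - 1).toNNReal := Real.toNNReal_pos.2 (by linarith)
    have : 0 < p.toNNReal := Real.toNNReal_pos.2 (by linarith)
    have : (0 : ℝ≥0) < 2 ^ (p - 1) := NNReal.rpow_pos (by norm_num)
    positivity
  refine ⟨_, hC, fun F => ?_⟩
  by_cases hfin : ∑' x, F x ^ p = ∞
  · rw [hfin, ENNReal.mul_top (ENNReal.coe_ne_zero.2 hC.ne')]
    exact le_top
  obtain ⟨B, hB, hFB⟩ : ∃ B : ℝ≥0∞, B ≠ ∞ ∧ ∀ x, F x ≤ B := by
    refine ⟨(∑' x, F x ^ p) ^ (1 / p), ENNReal.rpow_ne_top_of_nonneg (by positivity) hfin,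
      fun x => ?_⟩
    rw [one_div, ENNReal.le_rpow_inv_iff hp0]
    exact ENNReal.le_tsum x
  have hM : ∀ x, cubeMax F x ≠ ∞ := fun x => ((cubeMax_le_of_le hFB x).trans_lt hB.lt_top).ne
  have hF : ∀ x, F x ≠ ∞ := fun x => ((hFB x).trans_lt hB.lt_top).ne
  set ν : MeasureTheory.Measure (Fin d → ℤ) := MeasureTheory.Measure.count.withDensity F with hν
  have h1 := MeasureTheory.lintegral_rpow_eq_lintegral_meas_lt_mul
    (MeasureTheory.Measure.count : MeasureTheory.Measure (Fin d → ℤ))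
    (f := fun x => (cubeMax F x).toReal) (Filter.Eventually.of_forall fun x => by simp)
    Measurable.of_discrete.aemeasurable hp0
  have h2 := MeasureTheory.lintegral_rpow_eq_lintegral_meas_lt_mul ν
    (f := fun x => 2 * (F x).toReal) (Filter.Eventually.of_forall fun x => by simp)
    Measurable.of_discrete.aemeasurable (p := p - 1) (by linarith)
  have hlevel : ∀ t ∈ Set.Ioi (0 : ℝ),
      MeasureTheory.Measure.count {x | t < (cubeMax F x).toReal} * ENNReal.ofReal (t ^ (p - 1)) ≤
      (2 * 5 ^ d) * (ν {x | t < 2 * (F x).toReal} * ENNReal.ofReal (t ^ (p - 1 - 1))) := by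
    intro t ht
    have ht0 : 0 < t := ht
    have h3 := count_lt_cubeMax_mul_half_le F (ENNReal.ofReal t)
    have e1 : {x | t < (cubeMax F x).toReal} = {x | ENNReal.ofReal t < cubeMax F x} := by
      ext x
      exact (ENNReal.ofReal_lt_iff_lt_toReal ht0.le (hM x)).symm
    have e2 : {x | t < 2 * (F x).toReal} = {x | ENNReal.ofReal t / 2 < F x} := by
      ext x
      have : ENNReal.ofReal t / 2 = ENNReal.ofReal (t / 2) := by
        rw [ENNReal.ofReal_div_of_pos (by norm_num)]
        simp
      simp only [Set.mem_ofPred_eq, this]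
      rw [ENNReal.ofReal_lt_iff_lt_toReal (by positivity) (hF x), div_lt_iff₀' (by norm_num)]
    have e3 : ν {x | ENNReal.ofReal t / 2 < F x} =
        ∑' x, {x | ENNReal.ofReal t / 2 < F x}.indicator F x := by
      rw [hν, MeasureTheory.withDensity_apply _ MeasurableSet.of_discrete,
        ← MeasureTheory.lintegral_indicator MeasurableSet.of_discrete,
        MeasureTheory.lintegral_count]
    have e4 : ENNReal.ofReal (t ^ (p - 1)) =
        ENNReal.ofReal t / 2 * (2 * ENNReal.ofReal (t ^ (p - 1 - 1))) := by
      rw [← mul_assoc, ENNReal.div_mul_cancel (by norm_num) (by norm_num),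
        ← ENNReal.ofReal_mul ht0.le, Real.rpow_sub_one ht0.ne' (p - 1), mul_div_cancel₀ _ ht0.ne']
    rw [e1, e2, e3, e4, ← mul_assoc]
    calc _ ≤ 5 ^ d * (∑' x, {x | ENNReal.ofReal t / 2 < F x}.indicator F x) *
          (2 * ENNReal.ofReal (t ^ (p - 1 - 1))) := by gcongr
      _ = _ := by ring
  have h4 : ∑' x, cubeMax F x ^ p = ∫⁻ x, ENNReal.ofReal ((cubeMax F x).toReal ^ p)
      ∂MeasureTheory.Measure.count := by
    rw [MeasureTheory.lintegral_count]
    refine tsum_congr fun x => ?_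
    rw [← ENNReal.ofReal_rpow_of_nonneg (by simp) hp0.le, ENNReal.ofReal_toReal (hM x)]
  have h5 : ∫⁻ x, ENNReal.ofReal ((2 * (F x).toReal) ^ (p - 1)) ∂ν =
      2 ^ (p - 1) * ∑' x, F x ^ p := by
    rw [hν, MeasureTheory.lintegral_withDensity_eq_lintegral_mul _ Measurable.of_discrete
      Measurable.of_discrete, MeasureTheory.lintegral_count, ← ENNReal.tsum_mul_left]
    refine tsum_congr fun x => ?_
    rw [Pi.mul_apply, ← ENNReal.ofReal_rpow_of_nonneg (by positivity) (by linarith),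
      ENNReal.ofReal_mul (by norm_num), ENNReal.ofReal_toReal (hF x),
      ENNReal.mul_rpow_of_nonneg _ _ (by linarith)]
    have : F x ^ p = F x * F x ^ (p - 1) := by
      conv_rhs => rw [← ENNReal.rpow_one (F x), ← ENNReal.rpow_mul, one_mul]
      rw [← ENNReal.rpow_add_of_nonneg _ _ (by norm_num) (by linarith)]
      congr 1
      ring
    rw [this]
    simp
    ring
  rw [h4, h1]
  rw [h5] at h2
  have hp1 : ENNReal.ofReal (p - 1) ≠ 0 := by simpa using hp
  calc _ ≤ ENNReal.ofReal p * ∫⁻ t in Set.Ioi (0 : ℝ), (2 * 5 ^ d) *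
        (ν {x | t < 2 * (F x).toReal} * ENNReal.ofReal (t ^ (p - 1 - 1))) := by
        gcongr 1
        exact MeasureTheory.setLIntegral_mono' measurableSet_Ioi hlevel
    _ = ENNReal.ofReal p * (2 * 5 ^ d) * (∫⁻ t in Set.Ioi (0 : ℝ),
        (ν {x | t < 2 * (F x).toReal} * ENNReal.ofReal (t ^ (p - 1 - 1)))) := by
        rw [MeasureTheory.lintegral_const_mul' _ _ (by finiteness), mul_assoc (ENNReal.ofReal p)]
    _ = ENNReal.ofReal p * (2 * 5 ^ d) * ((ENNReal.ofReal (p - 1))⁻¹ *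
        (2 ^ (p - 1) * ∑' x, F x ^ p)) := by
        rw [h2, ← mul_assoc (ENNReal.ofReal (p - 1))⁻¹,
          ENNReal.inv_mul_cancel hp1 ENNReal.ofReal_ne_top, one_mul]
    _ = _ := by
        have : (p - 1).toNNReal ≠ 0 := by simpa using hp
        push_cast [ENNReal.coe_inv this, ENNReal.coe_rpow_of_nonneg (2 : ℝ≥0) (by linarith : 0 ≤ p - 1)]
        simp only [ENNReal.ofReal]
        ring

lemma le_lpNormE {d : ℕ} {q : ℝ} (hq : 0 < q) (F : (Fin d → ℤ) → ℝ≥0∞) (x : Fin d → ℤ) :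
    F x ≤ lpNormE d q F := by
  rw [lpNormE, one_div, ENNReal.le_rpow_inv_iff hq]
  exact ENNReal.le_tsum x

lemma lpNormE_mono {d : ℕ} {q : ℝ} (hq : 0 < q) {F G : (Fin d → ℤ) → ℝ≥0∞}
    (h : ∀ x, F x ≤ G x) : lpNormE d q F ≤ lpNormE d q G := by
  refine ENNReal.rpow_le_rpow (ENNReal.tsum_le_tsum fun x => ?_) (by positivity)
  exact ENNReal.rpow_le_rpow (h x) hq.le

lemma lpNormE_const_mul {d : ℕ} {q : ℝ} (hq : 0 < q) (c : ℝ≥0∞) (F : (Fin d → ℤ) → ℝ≥0∞) :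
    lpNormE d q (fun x => c * F x) = c * lpNormE d q F := by
  simp only [lpNormE, ENNReal.mul_rpow_of_nonneg _ _ hq.le, ENNReal.tsum_mul_left]
  rw [ENNReal.mul_rpow_of_nonneg _ _ (by positivity), ← ENNReal.rpow_mul,
    mul_one_div_cancel hq.ne', ENNReal.rpow_one]

/-- The `ℓ^q` norms decrease in `q`. -/
lemma lpNormE_anti {d : ℕ} {q r : ℝ} (hq : 0 < q) (hqr : q ≤ r) (F : (Fin d → ℤ) → ℝ≥0∞) :
    lpNormE d r F ≤ lpNormE d q F := by
  have hr : 0 < r := hq.trans_le hqr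
  set A := lpNormE d q F with hA
  have hAq : ∑' x, F x ^ q = A ^ q := by
    rw [hA, lpNormE, ← ENNReal.rpow_mul, one_div_mul_cancel hq.ne', ENNReal.rpow_one]
  rw [lpNormE, one_div, ENNReal.rpow_inv_le_iff hr]
  have hsplit : ∀ a : ℝ≥0∞, a ^ r = a ^ q * a ^ (r - q) := fun a => by
    rw [← ENNReal.rpow_add_of_nonneg _ _ hq.le (by linarith)]
    congr 1
    ring
  calc ∑' x, F x ^ r ≤ ∑' x, F x ^ q * A ^ (r - q) := by
        refine ENNReal.tsum_le_tsum fun x => ?_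
        rw [hsplit]
        gcongr
        exact le_lpNormE hq F x
    _ = A ^ r := by rw [ENNReal.tsum_mul_right, hAq, ← hsplit]

/-- Hölder's inequality for finitely many functions on `ℤ^d`. -/
lemma lpNormE_prod_le {d : ℕ} {ι : Type*} [Fintype ι] {p : ι → ℝ} (hp : ∀ i, 0 < p i) {r : ℝ}
    (hr : 0 < r) (hpr : 1 / r ≤ ∑ i, 1 / p i) (H : ι → (Fin d → ℤ) → ℝ≥0∞) :
    lpNormE d r (fun x => ∏ i, H i x) ≤ ∏ i, lpNormE d (p i) (H i) := by
  set s := ∑ i, 1 / p i with hs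
  have hs0 : 0 < s := lt_of_lt_of_le (by positivity) hpr
  have hq : 0 < 1 / s := by positivity
  refine (lpNormE_anti hq ((one_div_le hr hs0).1 hpr) _).trans ?_
  have hH : ∀ x, (∏ i, H i x) ^ (1 / s) = ∏ i, (H i x ^ p i) ^ (1 / p i / s) := fun x => by
    rw [← ENNReal.prod_rpow_of_nonneg hq.le]
    refine Finset.prod_congr rfl fun i _ => ?_
    rw [← ENNReal.rpow_mul]
    congr 1
    have := (hp i).ne'
    field_simp
  have key : ∑' x, (∏ i, H i x) ^ (1 / s) ≤ ∏ i, (∑' x, H i x ^ p i) ^ (1 / p i / s) := by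
    simp_rw [hH, ← MeasureTheory.lintegral_count]
    refine ENNReal.lintegral_prod_norm_pow_le Finset.univ
      (fun i _ => Measurable.of_discrete.aemeasurable) ?_ fun i _ => ?_
    · rw [← Finset.sum_div, ← hs, div_self hs0.ne']
    · have := hp i
      positivity
  refine (ENNReal.rpow_le_rpow key (by positivity)).trans_eq ?_
  rw [← ENNReal.prod_rpow_of_nonneg (by positivity)]
  refine Finset.prod_congr rfl fun i _ => ?_
  rw [lpNormE, ← ENNReal.rpow_mul]
  congr 1
  field_simp

lemma exists_lpNormE_cubeMax_le (d : ℕ) {p : ℝ} (hp : 1 < p) :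
    ∃ C : ℝ≥0, 0 < C ∧ ∀ f : (Fin d → ℤ) → ℂ,
      lpNormE d p (cubeMax fun x => ‖f x‖ₑ) ≤ C * lpNorm d p f := by
  obtain ⟨C, hC, h⟩ := exists_tsum_cubeMax_rpow_le d hp
  refine ⟨C ^ (1 / p), NNReal.rpow_pos hC, fun f => ?_⟩
  have h0 : 0 ≤ 1 / p := by positivity
  rw [ENNReal.coe_rpow_of_nonneg _ h0, lpNorm, ← ENNReal.mul_rpow_of_nonneg _ _ h0]
  exact ENNReal.rpow_le_rpow (h _) h0

lemma normK_nonneg {d : ℕ} (k : ℕ) (u : Fin d → ℤ) : 0 ≤ normK k u :=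
  Finset.sum_nonneg fun _ _ => by positivity

lemma mem_discreteCube_of_normK_lt {d k N : ℕ} {u : Fin d → ℤ}
    (h : normK k u < ((N : ℤ) + 1) ^ k) : u ∈ discreteCube d N := by
  refine mem_discreteCube.2 fun j => Int.lt_add_one_iff.1 ?_
  refine lt_of_pow_lt_pow_left₀ k (by positivity) (lt_of_le_of_lt ?_ h)
  exact Finset.single_le_sum (f := fun j => |u j| ^ k) (fun _ _ => by positivity)
    (Finset.mem_univ j)

lemma mem_discreteCube_of_normK_le {d k : ℕ} (hk : k ≠ 0) {u : Fin d → ℤ} {n : ℕ}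
    (h : normK k u ≤ n) : u ∈ discreteCube d n := by
  refine mem_discreteCube_of_normK_lt (k := k) (h.trans_lt ?_)
  have := Nat.le_self_pow hk (n + 1)
  exact_mod_cast (Nat.lt_succ_self n).trans_le this

lemma tsum_sphere_eq {d k : ℕ} (hk : k ≠ 0) (f : (Fin d → ℤ) → ℂ) (x : Fin d → ℤ) (n : ℕ) :
    ∑' v, (if normK k v = (n : ℤ) then ‖f (x - v)‖ₑ else 0) =
      ‖∑ᶠ (v : Fin d → ℤ) (_ : normK k v = (n : ℤ)), ((‖f (x - v)‖ : ℝ) : ℂ)‖ₑ := by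
  rw [finsum_cond_eq_sum_of_cond_iff (fun v => ((‖f (x - v)‖ : ℝ) : ℂ))
      (p := fun v => normK k v = (n : ℤ)) (t := {v ∈ discreteCube d n | normK k v = (n : ℤ)}),
    tsum_eq_sum (s := discreteCube d n), ← Finset.sum_filter]
  · rw [← Complex.ofReal_sum, ← ofReal_norm, Complex.norm_real, Real.norm_of_nonneg
      (Finset.sum_nonneg fun _ _ => norm_nonneg _), ENNReal.ofReal_sum_of_nonneg
      fun _ _ => norm_nonneg _]
    simp only [ofReal_norm]
  · intro v hv
    exact if_neg fun h => hv (mem_discreteCube_of_normK_le hk h.le)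
  · intro v _
    rw [Finset.mem_filter]
    exact ⟨fun h => ⟨mem_discreteCube_of_normK_le hk h.le, h⟩, fun h => h.2⟩

lemma tsum_sphere_le_s9 {d k : ℕ} (hk : k ≠ 0) (hkd : k ≤ d) (f : (Fin d → ℤ) → ℂ) (x : Fin d → ℤ)
    {n lam : ℕ} (hn : n ≤ lam) (hlam : 1 ≤ lam) :
    ∑' v, (if normK k v = (n : ℤ) then ‖f (x - v)‖ₑ else 0) ≤
      (lam : ℝ≥0∞) ^ ((d : ℝ) / k - 1) * linSphMaxK d k (fun y => ((‖f y‖ : ℝ) : ℂ)) x := by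
  have he : 0 ≤ (d : ℝ) / k - 1 := by
    rw [sub_nonneg, one_le_div (by positivity)]
    exact_mod_cast hkd
  rcases Nat.eq_zero_or_pos n with rfl | hn0
  · have hsingle : ∑' v, (if normK k v = ((0 : ℕ) : ℤ) then ‖f (x - v)‖ₑ else 0) ≤ ‖f x‖ₑ := by
      rw [tsum_eq_single 0]
      · split_ifs <;> simp
      · intro v hv
        refine if_neg fun h => hv ?_
        have := mem_discreteCube.1 (mem_discreteCube_of_normK_le hk h.le)
        ext j
        simpa using this j
    refine hsingle.trans ?_
    rw [← one_mul ‖f x‖ₑ]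
    gcongr
    · exact by simpa using ENNReal.rpow_le_rpow (by exact_mod_cast hlam : (1 : ℝ≥0∞) ≤ lam) he
    · refine le_trans (le_of_eq ?_) (le_max_left _ _)
      change ‖f x‖ₑ = ‖((‖f x‖ : ℝ) : ℂ)‖ₑ
      rw [← ofReal_norm, ← ofReal_norm, Complex.norm_real, norm_norm]
  · have h : ((n : ℝ≥0∞) ^ ((d : ℝ) / k - 1))⁻¹ *
        ‖∑ᶠ (v : Fin d → ℤ) (_ : normK k v = (n : ℤ)), ((‖f (x - v)‖ : ℝ) : ℂ)‖ₑ ≤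
        linSphMaxK d k (fun y => ((‖f y‖ : ℝ) : ℂ)) x :=
      le_trans (le_iSup₂ (f := fun (μ : ℕ) (_ : 1 ≤ μ) => ((μ : ℝ≥0∞) ^ ((d : ℝ) / k - 1))⁻¹ *
        ‖∑ᶠ (v : Fin d → ℤ) (_ : normK k v = (μ : ℤ)), ((‖f (x - v)‖ : ℝ) : ℂ)‖ₑ) n hn0)
        (le_max_right _ _)
    rw [← tsum_sphere_eq hk, mul_comm, ← div_eq_mul_inv, ENNReal.div_le_iff
      (ENNReal.rpow_pos (by exact_mod_cast hn0) (ENNReal.natCast_ne_top n)).ne'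
      (ENNReal.rpow_ne_top_of_nonneg he (ENNReal.natCast_ne_top n)), mul_comm] at h
    refine h.trans ?_
    gcongr

lemma enorm_multAvgK_le {d k l : ℕ} (hk : k ≠ 0) (f : Fin l → (Fin d → ℤ) → ℂ) {lam : ℕ}
    (hlam : 1 ≤ lam) (x : Fin d → ℤ) :
    ‖multAvgK d k l f lam x‖ₑ ≤ ((lam : ℝ≥0∞) ^ (((l * d : ℕ) : ℝ) / k - 1))⁻¹ *
      ∑' u : Fin l → Fin d → ℤ,
        if ∑ i, normK k (u i) = (lam : ℤ) then ∏ i, ‖f i (x - u i)‖ₑ else 0 := by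
  have hlam0 : (0 : ℝ) < lam := by exact_mod_cast hlam
  rw [multAvgK, enorm_mul, ← ofReal_norm, Complex.norm_real,
    Real.norm_of_nonneg (by positivity), ENNReal.ofReal_inv_of_pos (by positivity),
    ← ENNReal.ofReal_rpow_of_pos hlam0, ENNReal.ofReal_natCast]
  gcongr
  rw [finsum_cond_eq_sum_of_cond_iff (fun u => ∏ i, f i (x - u i))
    (p := fun u => ∑ i, normK k (u i) = (lam : ℤ))
    (t := {u ∈ Fintype.piFinset fun _ => discreteCube d lam | ∑ i, normK k (u i) = (lam : ℤ)})]
  · refine (enorm_sum_le _ _).trans ?_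
    rw [Finset.sum_filter]
    refine le_trans (Finset.sum_le_sum fun u _ => ?_) (ENNReal.sum_le_tsum _)
    split_ifs
    · simp [enorm_eq_nnnorm]
    · exact le_rfl
  · intro u _
    rw [Finset.mem_filter]
    refine ⟨fun h => ⟨Fintype.mem_piFinset.2 fun i => ?_, h⟩, fun h => h.2⟩
    refine mem_discreteCube_of_normK_le hk (le_trans ?_ h.le)
    exact Finset.single_le_sum (f := fun i => normK k (u i)) (fun _ _ => normK_nonneg _ _)
      (Finset.mem_univ i)

lemma sum_discreteCube_le {d : ℕ} (F : (Fin d → ℤ) → ℝ≥0∞) (x : Fin d → ℤ) (N : ℕ) :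
    ∑ u ∈ discreteCube d N, F (x - u) ≤ ((2 * N + 1 : ℕ) : ℝ≥0∞) ^ d * cubeMax F x := by
  have h := le_iSup (fun N : ℕ => (((2 * N + 1 : ℕ) : ℝ≥0∞) ^ d)⁻¹ *
    ∑ u ∈ discreteCube d N, F (x - u)) N
  rw [mul_comm, ← div_eq_mul_inv, ENNReal.div_le_iff (by positivity)
    (ENNReal.pow_ne_top (ENNReal.natCast_ne_top _)), mul_comm] at h
  exact h

lemma exists_pow_le_lt_succ_pow {k lam : ℕ} (hk : k ≠ 0) (hlam : 1 ≤ lam) :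
    ∃ N : ℕ, 1 ≤ N ∧ N ^ k ≤ lam ∧ lam < (N + 1) ^ k := by
  have hex : ∃ M, lam < (M + 1) ^ k := ⟨lam, lam.lt_succ_self.trans_le (Nat.le_self_pow hk _)⟩
  have h0 : Nat.find hex ≠ 0 := fun h => by
    have := Nat.find_spec hex
    rw [h, zero_add, one_pow] at this
    omega
  refine ⟨Nat.find hex, Nat.one_le_iff_ne_zero.2 h0, ?_, Nat.find_spec hex⟩
  have := Nat.find_min hex (Nat.sub_one_lt h0)
  rwa [Nat.sub_add_cancel (Nat.one_le_iff_ne_zero.2 h0), not_lt] at this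

lemma two_mul_add_one_pow_le {d k N lam : ℕ} (hk : k ≠ 0) (hN : 1 ≤ N) (h : N ^ k ≤ lam) :
    ((2 * N + 1 : ℕ) : ℝ≥0∞) ^ d ≤ 3 ^ d * (lam : ℝ≥0∞) ^ ((d : ℝ) / k) := by
  have h1 : (N : ℝ≥0∞) ≤ (lam : ℝ≥0∞) ^ (1 / (k : ℝ)) := by
    rw [one_div, ENNReal.le_rpow_inv_iff (by positivity), ENNReal.rpow_natCast]
    exact_mod_cast h
  have h2 : ((2 * N + 1 : ℕ) : ℝ≥0∞) ≤ 3 * N := by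
    exact_mod_cast (by omega : 2 * N + 1 ≤ 3 * N)
  calc ((2 * N + 1 : ℕ) : ℝ≥0∞) ^ d ≤ (3 * (lam : ℝ≥0∞) ^ (1 / (k : ℝ))) ^ d := by
        gcongr
        exact h2.trans (by gcongr)
    _ = _ := by
        rw [mul_pow, ← ENNReal.rpow_natCast (_ ^ _), ← ENNReal.rpow_mul, one_div_mul_eq_div]

lemma tsum_multilinear_sphere_le {d k m : ℕ} (hk : k ≠ 0) (hkd : k ≤ d)
    (f : Fin (m + 1) → (Fin d → ℤ) → ℂ) (x : Fin d → ℤ) {N lam : ℕ} (hlam : 1 ≤ lam)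
    (hN : lam < (N + 1) ^ k) :
    (∑' u : Fin (m + 1) → Fin d → ℤ,
        if ∑ i, normK k (u i) = (lam : ℤ) then ∏ i, ‖f i (x - u i)‖ₑ else 0) ≤
      (∏ i : Fin m, ∑ u ∈ discreteCube d N, ‖f i.castSucc (x - u)‖ₑ) *
      ((lam : ℝ≥0∞) ^ ((d : ℝ) / k - 1) *
        linSphMaxK d k (fun y => ((‖f (Fin.last m) y‖ : ℝ) : ℂ)) x) := by
  rw [← (Fin.snocEquiv fun _ => Fin d → ℤ).tsum_eq, ENNReal.tsum_prod', ENNReal.tsum_comm]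
  simp only [Fin.snocEquiv_apply, Fin.sum_univ_castSucc, Fin.prod_univ_castSucc,
    Fin.snoc_castSucc, Fin.snoc_last]
  rw [Finset.prod_univ_sum, Finset.sum_mul]
  set B := (lam : ℝ≥0∞) ^ ((d : ℝ) / k - 1) *
    linSphMaxK d k (fun y => ((‖f (Fin.last m) y‖ : ℝ) : ℂ)) x
  rw [tsum_eq_sum (s := Fintype.piFinset fun _ : Fin m => discreteCube d N)]
  · refine Finset.sum_le_sum fun v _ => ?_
    have hA0 : 0 ≤ ∑ i, normK k (v i) := Finset.sum_nonneg fun _ _ => normK_nonneg _ _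
    by_cases hA : ∑ i, normK k (v i) ≤ lam
    · obtain ⟨n, hn⟩ := Int.eq_ofNat_of_zero_le (sub_nonneg.2 hA)
      refine le_trans (le_of_eq ?_) (mul_le_mul_right
        (tsum_sphere_le_s9 hk hkd (f (Fin.last m)) x (n := n) (lam := lam) (by omega) hlam) _)
      rw [← ENNReal.tsum_mul_left]
      refine tsum_congr fun w => ?_
      rw [mul_ite, mul_zero]
      refine if_congr ?_ rfl rfl
      omega
    · refine le_trans (le_of_eq ?_) zero_le
      refine ENNReal.tsum_eq_zero.2 fun w => if_neg ?_
      have := normK_nonneg k w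
      omega
  · intro v hv
    refine ENNReal.tsum_eq_zero.2 fun w => if_neg fun h => hv ?_
    refine Fintype.mem_piFinset.2 fun i => mem_discreteCube_of_normK_lt (k := k) ?_
    have h1 := Finset.single_le_sum (f := fun i => normK k (v i)) (fun _ _ => normK_nonneg _ _)
      (Finset.mem_univ i)
    have h2 := normK_nonneg k w
    have h3 : (lam : ℤ) < ((N : ℤ) + 1) ^ k := by exact_mod_cast hN
    omega

lemma multMaxK_le {d k m : ℕ} (hk : k ≠ 0) (hkd : k ≤ d)
    (f : Fin (m + 1) → (Fin d → ℤ) → ℂ) (x : Fin d → ℤ) :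
    multMaxK d k (m + 1) f x ≤ (3 ^ d) ^ m *
      ((∏ i : Fin m, cubeMax (fun y => ‖f i.castSucc y‖ₑ) x) *
        linSphMaxK d k (fun y => ((‖f (Fin.last m) y‖ : ℝ) : ℂ)) x) := by
  refine iSup₂_le fun lam hlam => (enorm_multAvgK_le hk f hlam x).trans ?_
  obtain ⟨N, hN1, hNl, hNu⟩ := exists_pow_le_lt_succ_pow hk hlam
  have hlam0 : (lam : ℝ≥0∞) ≠ 0 := by exact_mod_cast (by omega : lam ≠ 0)
  have hlamt : (lam : ℝ≥0∞) ≠ ∞ := ENNReal.natCast_ne_top _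
  set S := linSphMaxK d k (fun y => ((‖f (Fin.last m) y‖ : ℝ) : ℂ)) x
  have hprod : ∏ i : Fin m, ∑ u ∈ discreteCube d N, ‖f i.castSucc (x - u)‖ₑ ≤
      (3 ^ d * (lam : ℝ≥0∞) ^ ((d : ℝ) / k)) ^ m *
        ∏ i : Fin m, cubeMax (fun y => ‖f i.castSucc y‖ₑ) x := by
    calc _ ≤ ∏ i : Fin m, (3 ^ d * (lam : ℝ≥0∞) ^ ((d : ℝ) / k)) *
          cubeMax (fun y => ‖f i.castSucc y‖ₑ) x :=
          Finset.prod_le_prod' fun i _ => (sum_discreteCube_le (fun y => ‖f i.castSucc y‖ₑ)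
            x N).trans (mul_le_mul_left (two_mul_add_one_pow_le hk hN1 hNl) _)
      _ = _ := by simp [Finset.prod_mul_distrib]
  have hexp : ((lam : ℝ≥0∞) ^ ((d : ℝ) / k)) ^ m * (lam : ℝ≥0∞) ^ ((d : ℝ) / k - 1) =
      (lam : ℝ≥0∞) ^ ((((m + 1) * d : ℕ) : ℝ) / k - 1) := by
    rw [← ENNReal.rpow_natCast, ← ENNReal.rpow_mul, ← ENNReal.rpow_add _ _ hlam0 hlamt]
    congr 1
    push_cast
    ring
  set Q := (lam : ℝ≥0∞) ^ ((((m + 1) * d : ℕ) : ℝ) / k - 1)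
  have hQ : Q⁻¹ * Q = 1 := ENNReal.inv_mul_cancel
    (ENNReal.rpow_pos (pos_iff_ne_zero.2 hlam0) hlamt).ne'
    (ENNReal.rpow_ne_top_of_ne_zero hlam0 hlamt)
  set P := ∏ i : Fin m, cubeMax (fun y => ‖f i.castSucc y‖ₑ) x
  calc _ ≤ Q⁻¹ * ((3 ^ d * (lam : ℝ≥0∞) ^ ((d : ℝ) / k)) ^ m * P *
        ((lam : ℝ≥0∞) ^ ((d : ℝ) / k - 1) * S)) := by
        gcongr 1
        refine (tsum_multilinear_sphere_le hk hkd f x hlam hNu).trans ?_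
        gcongr
    _ = Q⁻¹ * (((lam : ℝ≥0∞) ^ ((d : ℝ) / k)) ^ m * (lam : ℝ≥0∞) ^ ((d : ℝ) / k - 1)) *
        ((3 ^ d) ^ m * (P * S)) := by ring
    _ = _ := by rw [hexp, hQ, one_mul]

/-- A bound for the linear spherical maximal operator on some `ℓ^p(ℤ^d)` forces `k ≤ d`:
otherwise the image of a point mass is unbounded. -/
lemma le_dim_of_linSphMaxK_bounded {d k : ℕ} (hd : 1 ≤ d) {p : ℝ} (hp : 0 < p) {C : ℝ≥0}
    (h : ∀ g : (Fin d → ℤ) → ℂ, lpNormE d p (linSphMaxK d k g) ≤ C * lpNorm d p g) : k ≤ d := by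
  by_contra! hkd
  obtain ⟨n, hn⟩ := exists_nat_gt C
  have hn0 : 1 ≤ n := by
    rcases Nat.eq_zero_or_pos n with rfl | h
    · simp at hn
    · exact h
  set x : Fin d → ℤ := Pi.single ⟨0, hd⟩ (n : ℤ) with hx
  set g : (Fin d → ℤ) → ℂ := Pi.single 0 1 with hg
  have hgn : lpNorm d p g = 1 := by
    rw [lpNorm, tsum_eq_single 0]
    · simp [hg]
    · intro y hy
      simp [hg, hy, hp]
  have hxn : normK k x = ((n ^ k : ℕ) : ℤ) := by
    rw [normK, Finset.sum_eq_single ⟨0, hd⟩]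
    · simp [hx]
    · intro j _ hj
      simpa [hx, hj] using (by omega : k ≠ 0)
    · simp
  have hsum : ∑ᶠ (v : Fin d → ℤ) (_ : normK k v = ((n ^ k : ℕ) : ℤ)), g (x - v) = 1 := by
    rw [finsum_cond_eq_sum_of_cond_iff (fun v => g (x - v))
      (p := fun v => normK k v = ((n ^ k : ℕ) : ℤ)) (t := {x})]
    · simp [hg]
    · intro v hv
      have : v = x := by
        by_contra hne
        exact hv (by rw [hg, Pi.single_eq_of_ne (sub_ne_zero.2 (Ne.symm hne))])
      simp [this, hxn]
  have hlow : (n : ℝ≥0∞) ≤ linSphMaxK d k g x := by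
    refine le_trans ?_ (le_trans (le_iSup₂ (f := fun (μ : ℕ) (_ : 1 ≤ μ) =>
      ((μ : ℝ≥0∞) ^ ((d : ℝ) / k - 1))⁻¹ *
      ‖∑ᶠ (v : Fin d → ℤ) (_ : normK k v = (μ : ℤ)), g (x - v)‖ₑ) (n ^ k)
      (Nat.one_le_pow _ _ hn0)) (le_max_right _ _))
    simp only [hsum, enorm_one, mul_one]
    have hk0 : (k : ℝ) ≠ 0 := by exact_mod_cast (by omega : k ≠ 0)
    rw [← ENNReal.rpow_neg, Nat.cast_pow, ← ENNReal.rpow_natCast, ← ENNReal.rpow_mul]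
    have he : (k : ℝ) * -((d : ℝ) / k - 1) = k - d := by
      field_simp
      ring
    rw [he]
    conv_lhs => rw [← ENNReal.rpow_one (n : ℝ≥0∞)]
    refine ENNReal.rpow_le_rpow_of_exponent_le (by exact_mod_cast hn0) ?_
    have : (d : ℝ) + 1 ≤ k := by exact_mod_cast hkd
    linarith
  have := (hlow.trans (le_lpNormE hp _ x)).trans (h g)
  rw [hgn, mul_one] at this
  exact absurd (by exact_mod_cast this : (n : ℝ≥0) ≤ C) (not_le.2 hn)

lemma lpNorm_ofReal_norm {d : ℕ} (p : ℝ) (f : (Fin d → ℤ) → ℂ) :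
    lpNorm d p (fun y => ((‖f y‖ : ℝ) : ℂ)) = lpNorm d p f := by
  simp [lpNorm]

/-- If the linear degree-`k` discrete spherical maximal operator is bounded on `ℓ^p(ℤ^d)`
for every `p > p₀`, then the `ℓ`-linear degree-`k` discrete spherical maximal operator is
bounded `ℓ^{p_1} × ⋯ × ℓ^{p_ℓ} → ℓ^r` whenever `1 < p_i` for `i ≤ ℓ-1`, `p₀ < p_ℓ` and
`1/r ≤ 1/p_1 + ⋯ + 1/p_ℓ`. -/
theorem discrete_multilinear_degree_k_spherical_maximal_bounded
    (d k l : ℕ) (hk : 2 ≤ k) (hd : 1 ≤ d) (hl : 2 ≤ l) (hld : k ≤ (l - 1) * d)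
    (p₀ : ℝ) (hp₀ : 1 < p₀)
    (hS : ∀ p : ℝ, p₀ < p → ∃ Cp : ℝ≥0, 0 < Cp ∧ ∀ g : (Fin d → ℤ) → ℂ,
      lpNormE d p (linSphMaxK d k g) ≤ (Cp : ℝ≥0∞) * lpNorm d p g)
    (p : Fin l → ℝ) (r : ℝ)
    (hp : ∀ i : Fin l, (i : ℕ) + 1 < l → 1 < p i)
    (hpl : ∀ i : Fin l, (i : ℕ) + 1 = l → p₀ < p i)
    (hr : 0 < r) (hpr : 1 / r ≤ ∑ i, 1 / p i) :
    ∃ C : ℝ≥0, 0 < C ∧ ∀ f : Fin l → (Fin d → ℤ) → ℂ,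
      lpNormE d r (multMaxK d k l f) ≤ (C : ℝ≥0∞) * ∏ i, lpNorm d (p i) (f i) := by
  have hk0 : k ≠ 0 := by omega
  obtain ⟨m, rfl⟩ : ∃ m, l = m + 1 := ⟨l - 1, by omega⟩
  have hkd : k ≤ d := by
    obtain ⟨C, -, hC⟩ := hS (p₀ + 1) (by linarith)
    exact le_dim_of_linSphMaxK_bounded hd (by linarith) hC
  have hp0 : ∀ i, 0 < p i := fun i => by
    rcases Nat.lt_or_eq_of_le (Nat.succ_le_of_lt i.isLt) with h | h
    · linarith [hp i h]
    · linarith [hpl i h]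
  obtain ⟨A, hA, hSA⟩ := hS (p (Fin.last m)) (hpl _ (by simp))
  choose B hB hMB using fun i : Fin m =>
    exists_lpNormE_cubeMax_le d (hp i.castSucc (by simp))
  refine ⟨(3 ^ d) ^ m * ((∏ i, B i) * A), ?_, fun f => ?_⟩
  · have : 0 < ∏ i, B i := Finset.prod_pos fun i _ => hB i
    positivity
  set H : Fin (m + 1) → (Fin d → ℤ) → ℝ≥0∞ :=
    Fin.snoc (α := fun _ => (Fin d → ℤ) → ℝ≥0∞)
      (fun i : Fin m => cubeMax fun y => ‖f i.castSucc y‖ₑ)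
      (linSphMaxK d k fun y => ((‖f (Fin.last m) y‖ : ℝ) : ℂ)) with hH
  calc lpNormE d r (multMaxK d k (m + 1) f)
      ≤ lpNormE d r (fun x => (3 ^ d) ^ m * ∏ i, H i x) := by
        refine lpNormE_mono hr fun x => ?_
        simpa only [hH, Fin.prod_univ_castSucc, Fin.snoc_castSucc, Fin.snoc_last]
          using multMaxK_le hk0 hkd f x
    _ ≤ (3 ^ d) ^ m * ∏ i, lpNormE d (p i) (H i) := by
        rw [lpNormE_const_mul hr]
        gcongr
        exact lpNormE_prod_le hp0 hr hpr H
    _ ≤ (3 ^ d) ^ m * ((∏ i : Fin m, B i * lpNorm d (p i.castSucc) (f i.castSucc)) *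
        (A * lpNorm d (p (Fin.last m)) (f (Fin.last m)))) := by
        simp only [hH, Fin.prod_univ_castSucc, Fin.snoc_castSucc, Fin.snoc_last]
        gcongr with i
        · exact hMB i _
        · exact (hSA _).trans_eq (by rw [lpNorm_ofReal_norm])
    _ = _ := by
        rw [Fin.prod_univ_castSucc, Finset.prod_mul_distrib]
        push_cast
        ring
end
end

section
/- Let k ≥ 2, d ≥ 1, and ℓ ≥ 2 be integers with ℓd > k, and let 1 ≤ p_1, …, p_ℓ, r < ∞. If there exists a constant C > 0 such that ‖T^{k,ℓ,*}(f_1,…,f_ℓ)‖_{ℓ^r(ℤ^d)} ≤ C ∏_{i=1}^ℓ ‖f_i‖_{ℓ^{p_i}(ℤ^d)} holds for all finitely supported f_1, …, f_ℓ : ℤ^d → ℂ, then necessarily r > d/(ℓd-k). -/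
open scoped ENNReal NNReal BigOperators

noncomputable section

/-- The function equal to `1` at the origin and `0` elsewhere. -/
def originDelta (d : ℕ) : (Fin d → ℤ) → ℂ := Pi.single 0 1

lemma support_originDelta_finite (d : ℕ) : (Function.support (originDelta d)).Finite :=
  (Set.finite_singleton 0).subset Pi.support_single_subset

lemma lpNorm_originDelta (d : ℕ) {p : ℝ} (hp : 0 < p) : lpNorm d p (originDelta d) = 1 := by
  unfold lpNorm
  rw [tsum_eq_single 0]
  · simp [originDelta]
  · intro x hx
    simp [originDelta, hx, hp]

lemma multAvgK_originDelta (d k l lam : ℕ) (x : Fin d → ℤ)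
    (h : (l : ℤ) * normK k x = lam) :
    multAvgK d k l (fun _ => originDelta d) lam x =
      ((((lam : ℝ) ^ (((l * d : ℕ) : ℝ) / (k : ℝ) - 1))⁻¹ : ℝ) : ℂ) := by
  unfold multAvgK
  rw [finsum_eq_single _ (fun _ => x)]
  · simp [originDelta, h]
  · intro u hu
    obtain ⟨i, hi⟩ := Function.ne_iff.mp hu
    have hprod : ∏ i, originDelta d (x - u i) = 0 :=
      Finset.prod_eq_zero (Finset.mem_univ i)
        (Pi.single_eq_of_ne (sub_ne_zero.mpr (Ne.symm hi)) _)
    simp [hprod]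

lemma le_multMaxK_originDelta (d k l lam : ℕ) (hlam : 1 ≤ lam) (x : Fin d → ℤ)
    (h : (l : ℤ) * normK k x = lam) :
    ENNReal.ofReal ((lam : ℝ) ^ (((l * d : ℕ) : ℝ) / (k : ℝ) - 1))⁻¹ ≤
      multMaxK d k l (fun _ => originDelta d) x := by
  refine le_trans (le_of_eq ?_) (le_iSup₂ (f := fun (lam : ℕ) (_ : 1 ≤ lam) =>
    (‖multAvgK d k l (fun _ => originDelta d) lam x‖₊ : ℝ≥0∞)) lam hlam)
  rw [multAvgK_originDelta d k l lam x h, ← enorm_eq_nnnorm, ← ofReal_norm,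
    Complex.norm_real, Real.norm_of_nonneg (by positivity)]

/-- The lattice points all of whose coordinates lie in `[2 ^ m, 2 ^ (m + 1))`. -/
def dyadicPoint (d : ℕ) (z : Σ m : ℕ, Fin d → Fin (2 ^ m)) : Fin d → ℤ :=
  fun j => ((2 ^ z.1 + (z.2 j : ℕ) : ℕ) : ℤ)

lemma dyadicPoint_injective {d : ℕ} (hd : 1 ≤ d) : Function.Injective (dyadicPoint d) := by
  have hlog (m : ℕ) (a : Fin (2 ^ m)) : Nat.log 2 (2 ^ m + (a : ℕ)) = m :=
    Nat.log_eq_of_pow_le_of_lt_pow (by omega) (by have := a.2; rw [pow_succ]; omega)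
  rintro ⟨m, y⟩ ⟨n, z⟩ h
  have hcoord (j : Fin d) : 2 ^ m + (y j : ℕ) = 2 ^ n + (z j : ℕ) := by
    exact Nat.cast_injective (R := ℤ) (congrFun h j)
  obtain rfl : m = n := by
    rw [← hlog m (y ⟨0, hd⟩), hcoord, hlog]
  congr 1
  funext j
  exact Fin.ext (by have := hcoord j; omega)

lemma normK_dyadicPoint (d k : ℕ) (z : Σ m : ℕ, Fin d → Fin (2 ^ m)) :
    normK k (dyadicPoint d z) = ((∑ j, (2 ^ z.1 + (z.2 j : ℕ)) ^ k : ℕ) : ℤ) := by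
  unfold normK dyadicPoint
  simp only [Nat.abs_cast]
  push_cast
  rfl

lemma sum_dyadic_pow_le (d k m : ℕ) (y : Fin d → Fin (2 ^ m)) :
    ∑ j, (2 ^ m + (y j : ℕ)) ^ k ≤ d * (2 ^ k * (2 ^ m) ^ k) := by
  calc ∑ j, (2 ^ m + (y j : ℕ)) ^ k ≤ ∑ _j : Fin d, (2 * 2 ^ m) ^ k := by
        gcongr with j
        have := (y j).2
        omega
    _ = d * (2 ^ k * (2 ^ m) ^ k) := by simp [mul_pow]

lemma sum_dyadic_pow_pos {d : ℕ} (hd : 1 ≤ d) (k m : ℕ) (y : Fin d → Fin (2 ^ m)) :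
    0 < ∑ j, (2 ^ m + (y j : ℕ)) ^ k :=
  Finset.sum_pos (fun j _ => by positivity) ⟨⟨0, hd⟩, Finset.mem_univ _⟩

lemma le_multMaxK_dyadicPoint {d k l : ℕ} {r : ℝ} (hk : 0 < k) (hd : 1 ≤ d) (hl : 0 < l)
    (hld : k < l * d) (hr : 0 < r) (hcrit : r * (((l * d : ℕ) : ℝ) - k) ≤ d)
    (m : ℕ) (y : Fin d → Fin (2 ^ m)) :
    ENNReal.ofReal (((l * d * 2 ^ k : ℝ) ^ ((((l * d : ℕ) : ℝ) / k - 1) * r))⁻¹ *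
        ((2 ^ m : ℝ) ^ d)⁻¹) ≤
      multMaxK d k l (fun _ => originDelta d) (dyadicPoint d ⟨m, y⟩) ^ r := by
  set a : ℝ := ((l * d : ℕ) : ℝ) / k - 1 with ha
  set lam : ℕ := l * ∑ j, (2 ^ m + (y j : ℕ)) ^ k with hlam
  have hkR : (0 : ℝ) < k := by exact_mod_cast hk
  have hldR : (k : ℝ) < ((l * d : ℕ) : ℝ) := by exact_mod_cast hld
  have ha0 : 0 ≤ a := sub_nonneg.mpr ((one_le_div hkR).mpr hldR.le)
  have hlam1 : 1 ≤ lam := Nat.mul_pos hl (sum_dyadic_pow_pos hd k m y)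
  have hlam0 : (0 : ℝ) < lam := by exact_mod_cast hlam1
  have hlamle : (lam : ℝ) ≤ l * d * 2 ^ k * (2 ^ m : ℝ) ^ k := by
    have := Nat.mul_le_mul_left l (sum_dyadic_pow_le d k m y)
    rw [← hlam] at this
    calc (lam : ℝ) ≤ ((l * (d * (2 ^ k * (2 ^ m) ^ k)) : ℕ) : ℝ) := by exact_mod_cast this
      _ = _ := by push_cast; ring
  have hexp : (k : ℝ) * (a * r) ≤ d := by
    calc (k : ℝ) * (a * r) = r * (((l * d : ℕ) : ℝ) - k) := by rw [ha]; field_simp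
      _ ≤ d := hcrit
  have hpow : (lam : ℝ) ^ (a * r) ≤ (l * d * 2 ^ k : ℝ) ^ (a * r) * (2 ^ m : ℝ) ^ d := by
    calc (lam : ℝ) ^ (a * r) ≤ (l * d * 2 ^ k * (2 ^ m : ℝ) ^ k) ^ (a * r) := by gcongr
      _ = (l * d * 2 ^ k : ℝ) ^ (a * r) * (2 ^ m : ℝ) ^ ((k : ℝ) * (a * r)) := by
        rw [Real.mul_rpow (by positivity) (by positivity), Real.rpow_mul (x := 2 ^ m) (by positivity),
          Real.rpow_natCast]
      _ ≤ (l * d * 2 ^ k : ℝ) ^ (a * r) * (2 ^ m : ℝ) ^ (d : ℝ) := by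
        gcongr
        exact one_le_pow₀ one_le_two
      _ = _ := by rw [Real.rpow_natCast]
  calc ENNReal.ofReal (((l * d * 2 ^ k : ℝ) ^ (a * r))⁻¹ * ((2 ^ m : ℝ) ^ d)⁻¹)
      ≤ ENNReal.ofReal ((lam : ℝ) ^ (a * r))⁻¹ := by
        rw [← mul_inv]
        gcongr
    _ = ENNReal.ofReal ((lam : ℝ) ^ a)⁻¹ ^ r := by
        rw [ENNReal.ofReal_rpow_of_nonneg (by positivity) hr.le,
          Real.inv_rpow (by positivity), ← Real.rpow_mul hlam0.le]
    _ ≤ _ := by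
        gcongr
        refine le_multMaxK_originDelta d k l lam hlam1 _ ?_
        rw [normK_dyadicPoint, hlam]
        push_cast
        rfl

lemma lpNormE_multMaxK_originDelta {d k l : ℕ} {r : ℝ} (hk : 0 < k) (hd : 1 ≤ d) (hl : 0 < l)
    (hld : k < l * d) (hr : 0 < r) (hcrit : r * (((l * d : ℕ) : ℝ) - k) ≤ d) :
    lpNormE d r (multMaxK d k l (fun _ => originDelta d)) = ⊤ := by
  set K : ℝ := ((l * d * 2 ^ k : ℝ) ^ ((((l * d : ℕ) : ℝ) / k - 1) * r))⁻¹ with hK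
  have hK0 : 0 < K := by positivity
  have hsum : ∑' x, multMaxK d k l (fun _ => originDelta d) x ^ r = ⊤ := by
    rw [← top_le_iff]
    calc (⊤ : ℝ≥0∞) = ∑' _ : ℕ, ENNReal.ofReal K :=
          (ENNReal.tsum_const_eq_top_of_ne_zero (by simpa using hK0)).symm
      _ = ∑' (m : ℕ) (_ : Fin d → Fin (2 ^ m)), ENNReal.ofReal (K * ((2 ^ m : ℝ) ^ d)⁻¹) := by
          congr 1
          funext m
          rw [tsum_fintype, Finset.sum_const, Finset.card_univ, Fintype.card_fun,
            Fintype.card_fin, Fintype.card_fin, ← ENNReal.ofReal_nsmul, nsmul_eq_mul]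
          congr 1
          push_cast
          field_simp
      _ ≤ ∑' (m : ℕ) (y : Fin d → Fin (2 ^ m)),
            multMaxK d k l (fun _ => originDelta d) (dyadicPoint d ⟨m, y⟩) ^ r := by
          gcongr with m y
          exact le_multMaxK_dyadicPoint hk hd hl hld hr hcrit m y
      _ = ∑' z, multMaxK d k l (fun _ => originDelta d) (dyadicPoint d z) ^ r :=
          (ENNReal.tsum_sigma _).symm
      _ ≤ _ := ENNReal.tsum_comp_le_tsum_of_injective (dyadicPoint_injective hd)
          (fun x => multMaxK d k l (fun _ => originDelta d) x ^ r)
  rw [lpNormE, hsum, ENNReal.top_rpow_of_pos (by positivity)]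

/-- Necessity: for `k ≥ 2`, `d ≥ 1`, `ℓ ≥ 2` with `ℓd > k`, if the `ℓ`-linear degree-`k`
discrete spherical maximal operator is bounded `ℓ^{p_1} × ⋯ × ℓ^{p_ℓ} → ℓ^r` on finitely
supported functions, then `r > d/(ℓd-k)`. -/
theorem discrete_multilinear_degree_k_spherical_maximal_necessary
    (d k l : ℕ) (hk : 2 ≤ k) (hd : 1 ≤ d) (hl : 2 ≤ l) (hld : k < l * d)
    (p : Fin l → ℝ) (r : ℝ) (hp : ∀ i, 1 ≤ p i) (hr : 1 ≤ r) (C : ℝ≥0) (hC : 0 < C)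
    (hbound : ∀ f : Fin l → (Fin d → ℤ) → ℂ,
      (∀ i, (Function.support (f i)).Finite) →
      lpNormE d r (multMaxK d k l f) ≤ (C : ℝ≥0∞) * ∏ i, lpNorm d (p i) (f i)) :
    (d : ℝ) / (((l * d : ℕ) : ℝ) - (k : ℝ)) < r := by
  by_contra! hcrit
  have hk0 : 0 < k := by omega
  have hl0 : 0 < l := by omega
  have hr0 : 0 < r := by linarith
  have hpos : (0 : ℝ) < ((l * d : ℕ) : ℝ) - k := sub_pos.mpr (by exact_mod_cast hld)
  have hb := hbound (fun _ => originDelta d) fun _ => support_originDelta_finite d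
  rw [lpNormE_multMaxK_originDelta hk0 hd hl0 hld hr0 ((le_div_iff₀ hpos).mp hcrit),
    Finset.prod_eq_one fun i _ => lpNorm_originDelta d (zero_lt_one.trans_le (hp i)),
    mul_one, top_le_iff] at hb
  exact ENNReal.coe_ne_top hb
end
end

section
/- Let k ≥ 2, d ≥ 1, and ℓ ≥ 2 be integers with ℓd > k. Let f_1 = χ_{[-1,1]^d} be the indicator function of the cube {u ∈ ℤ^d : |u_i| ≤ 1 for all i} and let f_2 = … = f_ℓ = δ_0 be the indicator function of {0}. Then for every nonzero x ∈ ℤ^d, the ℓ-linear degree-k discrete spherical maximal function satisfies the lower bound T^{k,ℓ,*}(f_1, f_2, …, f_ℓ)(x) ≥ (ℓ |x|_k^k)^{-(ℓd/k - 1)}, obtained by testing the average at radius parameter λ = ℓ |x|_k^k. -/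
open scoped ENNReal NNReal BigOperators

noncomputable section

/-- The `ℓ`-linear degree-`k` discrete spherical maximal operator on nonnegative functions:
`T^{k,ℓ,*}(f_1,…,f_ℓ)(x) = sup_{λ ≥ 1} λ^{-(ℓd/k-1)} ∑_{|u_1|_k^k+⋯+|u_ℓ|_k^k=λ}
f_1(x-u_1)⋯f_ℓ(x-u_ℓ)`, valued in `ℝ≥0∞`. -/
def multMaxKNN (d k l : ℕ) (f : Fin l → (Fin d → ℤ) → ℝ≥0) (x : Fin d → ℤ) : ℝ≥0∞ :=
  ⨆ (lam : ℕ) (_ : 1 ≤ lam),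
    ((lam : ℝ≥0∞) ^ ((((l * d : ℕ) : ℝ)) / (k : ℝ) - 1))⁻¹ *
      ∑' u : {u : Fin l → Fin d → ℤ // ∑ i, normK k (u i) = (lam : ℤ)},
        ∏ i, (f i (x - u.1 i) : ℝ≥0∞)

theorem normK_pos {d : ℕ} (k : ℕ) {u : Fin d → ℤ} (hu : u ≠ 0) : 0 < normK k u := by
  obtain ⟨j, hj⟩ := Function.ne_iff.mp hu
  exact Finset.sum_pos' (fun _ _ => pow_nonneg (abs_nonneg _) _)
    ⟨j, Finset.mem_univ j, pow_pos (abs_pos.mpr hj) k⟩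

/-- If `lam ≥ 1` is the radius of a tuple `u` and every `f i` is at least `1` at `x - u i`,
the maximal function at `x` is at least the normalising factor of the radius `lam`. -/
theorem inv_rpow_le_multMaxKNN {d k l lam : ℕ} (f : Fin l → (Fin d → ℤ) → ℝ≥0)
    (x : Fin d → ℤ) (hlam : 1 ≤ lam) (u : Fin l → Fin d → ℤ)
    (hu : ∑ i, normK k (u i) = (lam : ℤ)) (hf : ∀ i, 1 ≤ f i (x - u i)) :
    ((lam : ℝ≥0∞) ^ ((((l * d : ℕ) : ℝ)) / (k : ℝ) - 1))⁻¹ ≤ multMaxKNN d k l f x := by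
  refine le_iSup₂_of_le lam hlam (le_mul_of_one_le_right' ?_)
  calc (1 : ℝ≥0∞) ≤ ∏ i, (f i (x - u i) : ℝ≥0∞) :=
        Finset.one_le_prod' fun i _ => by exact_mod_cast hf i
    _ ≤ _ := ENNReal.le_tsum
        (f := fun v : {v : Fin l → Fin d → ℤ // ∑ i, normK k (v i) = (lam : ℤ)} =>
          ∏ i, (f i (x - v.1 i) : ℝ≥0∞)) ⟨u, hu⟩

/-- With `f_1 = χ_{[-1,1]^d}` and `f_2 = ⋯ = f_ℓ = δ₀`, for every nonzero `x ∈ ℤ^d` one has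
`T^{k,ℓ,*}(f_1,…,f_ℓ)(x) ≥ (ℓ|x|_k^k)^{-(ℓd/k-1)}`
(testing at radius parameter `λ = ℓ|x|_k^k`). -/
theorem multilinear_degree_k_lower_bound
    (d k l : ℕ) (hk : 2 ≤ k) (hd : 1 ≤ d) (hl : 2 ≤ l) (hld : k < l * d)
    (x : Fin d → ℤ) (hx : x ≠ 0) :
    ((((l * (normK k x).toNat : ℕ) : ℝ≥0∞) ^ ((((l * d : ℕ) : ℝ)) / (k : ℝ) - 1))⁻¹ ≤
      multMaxKNN d k l
        (fun i u => if (i : ℕ) = 0 then (if ∀ j, |u j| ≤ 1 then 1 else 0)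
          else (if u = 0 then 1 else 0)) x) := by
  have hpos := normK_pos k hx
  refine inv_rpow_le_multMaxKNN _ x ?_ (fun _ => x) ?_ fun i => ?_
  · exact Nat.mul_pos (by omega) (by omega)
  · simp [Int.toNat_of_nonneg hpos.le]
  · simp
end
end
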